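/- Let K be an origin symmetric convex body in ℝ^d (so K = −K). Then its centroid body satisfies Γ K = 2 · conv( ∪_{t ∈ (0,1]} t · E_t(K) ), where conv denotes the closed convex hull; equivalently, for every u ∈ ℝ^d, (1/V_d(K))∫_K |⟨x,u⟩| dx = 2 · sup_{t ∈ (0,1]} t · e_t(⟨ξ,u⟩), where ξ is uniformly distributed on K. -/

import Mathlib

open MeasureTheory Pointwise RealInnerProductSpace

/-- The `t`-quantile of a distribution `ν` on `ℝ`: `q_t = inf {s : ν(-∞,s] ≥ t}`. -/
noncomputable def quantile (ν : Measure ℝ) (t : ℝ) : ℝ :=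
  sInf {s : ℝ | t ≤ (ν (Set.Iic s)).toReal}

/-- The average quantile `e_α(β) = α⁻¹ ∫_{1−α}^1 q_t(β) dt` of a distribution `ν` on `ℝ`. -/
noncomputable def avgQuantile (ν : Measure ℝ) (α : ℝ) : ℝ :=
  α⁻¹ * ∫ t in Set.Ioc (1 - α) 1, quantile ν t

/-- The average quantile set `E_α(ξ)`: the convex closed set with support function
`u ↦ e_α(⟨ξ,u⟩)`. -/
def avgQuantileSet {Ω : Type*} [MeasureSpace Ω] {d : ℕ}
    (ξ : Ω → EuclideanSpace ℝ (Fin d)) (α : ℝ) : Set (EuclideanSpace ℝ (Fin d)) :=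
  {x | ∀ u : EuclideanSpace ℝ (Fin d),
    ⟪x, u⟫ ≤ avgQuantile (Measure.map (fun ω => ⟪ξ ω, u⟫) volume) α}

/-- The uniform distribution on a set `K` in `ℝ^d`: normalized Lebesgue measure on `K`. -/
noncomputable def unifOn {d : ℕ} (K : Set (EuclideanSpace ℝ (Fin d))) :
    Measure (EuclideanSpace ℝ (Fin d)) :=
  (volume K)⁻¹ • volume.restrict K

/-- The centroid body `Γ K` of a convex body `K ⊆ ℝ^d`: the convex body with support
function `h(Γ K, u) = (1/V_d(K)) ∫_K |⟨x,u⟩| dx`. -/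
def centroidBody {d : ℕ} (K : Set (EuclideanSpace ℝ (Fin d))) :
    Set (EuclideanSpace ℝ (Fin d)) :=
  {x | ∀ u : EuclideanSpace ℝ (Fin d),
    ⟪x, u⟫ ≤ (volume K).toReal⁻¹ * ∫ y in K, |⟪y, u⟫|}

section Quantile

open ProbabilityTheory Set

variable {ν : Measure ℝ}

lemma nonempty_setOf_le_cdf {t : ℝ} (ht : t < 1) : {s : ℝ | t ≤ cdf ν s}.Nonempty := by
  obtain ⟨s, hs⟩ := ((tendsto_cdf_atTop ν).eventually (lt_mem_nhds ht)).exists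
  exact ⟨s, hs.le⟩

lemma bddBelow_setOf_le_cdf {t : ℝ} (ht : 0 < t) : BddBelow {s : ℝ | t ≤ cdf ν s} := by
  obtain ⟨s, hs⟩ := ((tendsto_cdf_atBot ν).eventually (gt_mem_nhds ht)).exists
  refine ⟨s, fun r hr => ?_⟩
  by_contra! h
  exact absurd ((hr.trans (monotone_cdf ν h.le)).trans_lt hs) (lt_irrefl t)

lemma integral_abs_of_symmetric (hInt : Integrable (fun x : ℝ => x) ν)
    (hsymm : ν.map Neg.neg = ν) : ∫ x, |x| ∂ν = 2 * ∫ x, max x 0 ∂ν := by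
  have hneg : ∫ x, max (-x) 0 ∂ν = ∫ x, max x 0 ∂ν := by
    have hcont : Continuous fun x : ℝ => max x 0 := by fun_prop
    conv_rhs => rw [← hsymm]
    rw [integral_map measurable_neg.aemeasurable hcont.aestronglyMeasurable]
  have habs : ∀ x : ℝ, |x| = max x 0 + max (-x) 0 := fun x => by
    rcases le_total 0 x with h | h
    · rw [abs_of_nonneg h, max_eq_left h, max_eq_right (by linarith), add_zero]
    · rw [abs_of_nonpos h, max_eq_right h, max_eq_left (by linarith), zero_add]
  simp_rw [habs]
  rw [integral_add hInt.pos_part hInt.neg_part, hneg, two_mul]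

lemma mul_avgQuantile {t : ℝ} (ht : 0 < t) :
    t * avgQuantile ν t = ∫ s in Ioc (1 - t) 1, quantile ν s := by
  rw [avgQuantile, mul_inv_cancel_left₀ ht.ne']

variable [IsProbabilityMeasure ν]

lemma quantile_eq_sInf_cdf (t : ℝ) : quantile ν t = sInf {s : ℝ | t ≤ cdf ν s} := by
  simp only [quantile, cdf_eq_real, measureReal_def]

/-- The quantile function is the lower adjoint of the distribution function. -/
lemma quantile_le_iff {t : ℝ} (ht : t ∈ Ioo (0 : ℝ) 1) (x : ℝ) :
    quantile ν t ≤ x ↔ t ≤ cdf ν x := by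
  rw [quantile_eq_sInf_cdf]
  refine ⟨fun h => ?_, fun h => csInf_le (bddBelow_setOf_le_cdf ht.1) h⟩
  have hgt : ∀ y ∈ Ioi x, t ≤ cdf ν y := fun y hy => by
    obtain ⟨s, hs, hsy⟩ := exists_lt_of_csInf_lt (nonempty_setOf_le_cdf ht.2)
      (h.trans_lt (mem_Ioi.1 hy))
    exact hs.trans (monotone_cdf ν hsy.le)
  have hright : Filter.Tendsto (cdf ν) (nhdsWithin x (Ioi x)) (nhds (cdf ν x)) :=
    ((cdf ν).right_continuous x).mono_left (nhdsWithin_mono x Ioi_subset_Ici_self)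
  exact ge_of_tendsto hright (Filter.eventually_of_mem self_mem_nhdsWithin hgt)

lemma monotoneOn_quantile : MonotoneOn (quantile ν) (Ioo 0 1) := fun _ hs _ ht hst =>
  (quantile_le_iff hs _).2 (hst.trans ((quantile_le_iff ht _).1 le_rfl))

lemma aemeasurable_quantile : AEMeasurable (quantile ν) (volume.restrict (Ioo 0 1)) :=
  aemeasurable_restrict_of_monotoneOn measurableSet_Ioo monotoneOn_quantile

/-- The quantile function of `ν`, evaluated at a uniform variable, has law `ν`. -/
lemma map_quantile : Measure.map (quantile ν) (volume.restrict (Ioo 0 1)) = ν := by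
  refine Measure.ext_of_Iic _ _ fun x => ?_
  rw [Measure.map_apply_of_aemeasurable aemeasurable_quantile measurableSet_Iic,
    Measure.restrict_apply' measurableSet_Ioo]
  have hset : quantile ν ⁻¹' Iic x ∩ Ioo 0 1 = Iic (cdf ν x) ∩ Ioo 0 1 := by
    ext s
    exact and_congr_left fun hs => quantile_le_iff hs x
  have hIoc : (Iic (cdf ν x) ∩ Ioo 0 1 : Set ℝ) =ᵐ[volume]
      (Iic (cdf ν x) ∩ Ioc 0 1 : Set ℝ) :=
    Filter.EventuallyEq.inter (ae_eq_refl _) Ioo_ae_eq_Ioc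
  have hinter : (Iic (cdf ν x) ∩ Ioc 0 1 : Set ℝ) = Ioc 0 (cdf ν x) := by
    ext s
    simp only [mem_inter_iff, mem_Iic, mem_Ioc]
    exact ⟨fun h => ⟨h.2.1, h.1⟩, fun h => ⟨h.2, h.1, h.2.trans (cdf_le_one ν x)⟩⟩
  rw [hset, measure_congr hIoc, hinter, Real.volume_Ioc, sub_zero, ofReal_cdf]

lemma integrableOn_quantile (hInt : Integrable (fun x : ℝ => x) ν) :
    IntegrableOn (quantile ν) (Ioc 0 1) := by
  rw [integrableOn_Ioc_iff_integrableOn_Ioo]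
  rw [← map_quantile (ν := ν)] at hInt
  exact hInt.comp_aemeasurable aemeasurable_quantile

lemma setIntegral_max_quantile_zero :
    ∫ s in Ioc (0 : ℝ) 1, max (quantile ν s) 0 = ∫ x, max x 0 ∂ν := by
  have hcont : Continuous fun x : ℝ => max x 0 := by fun_prop
  rw [integral_Ioc_eq_integral_Ioo, ← integral_map aemeasurable_quantile
    hcont.aestronglyMeasurable, map_quantile]

lemma setIntegral_quantile_le (hInt : Integrable (fun x : ℝ => x) ν) {t : ℝ}
    (ht : t ∈ Ioc (0 : ℝ) 1) :
    ∫ s in Ioc (1 - t) 1, quantile ν s ≤ ∫ x, max x 0 ∂ν := by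
  have hsub : Ioc (1 - t) 1 ⊆ Ioc (0 : ℝ) 1 := Ioc_subset_Ioc_left (by linarith [ht.2])
  have hq := integrableOn_quantile hInt
  have hpos : IntegrableOn (fun s => max (quantile ν s) 0) (Ioc 0 1) := hq.pos_part
  calc ∫ s in Ioc (1 - t) 1, quantile ν s
      ≤ ∫ s in Ioc (1 - t) 1, max (quantile ν s) 0 :=
        integral_mono (hq.mono_set hsub) (hpos.mono_set hsub) fun s => le_max_left _ _
    _ ≤ ∫ s in Ioc 0 1, max (quantile ν s) 0 :=
        setIntegral_mono_set hpos (ae_of_all _ fun s => le_max_right _ _) hsub.eventuallyLE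
    _ = ∫ x, max x 0 ∂ν := setIntegral_max_quantile_zero

lemma measureReal_Ici_neg (hsymm : ν.map Neg.neg = ν) (x : ℝ) :
    ν.real (Ici (-x)) = cdf ν x := by
  rw [cdf_eq_real]
  conv_rhs => rw [← hsymm]
  rw [map_measureReal_apply measurable_neg measurableSet_Iic]
  simp

lemma quantile_nonpos (hsymm : ν.map Neg.neg = ν) {s : ℝ} (hs : s ∈ Ioc (0 : ℝ) (1 / 2)) :
    quantile ν s ≤ 0 := by
  rw [quantile_le_iff ⟨hs.1, by linarith [hs.2]⟩]
  have h : (1 : ℝ) ≤ ν.real (Iic 0) + ν.real (Ici 0) := by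
    simpa using measureReal_union_le (μ := ν) (Iic (0 : ℝ)) (Ici 0)
  have h' := measureReal_Ici_neg hsymm 0
  rw [neg_zero] at h'
  rw [← cdf_eq_real, h'] at h
  linarith [hs.2]

lemma quantile_nonneg (hsymm : ν.map Neg.neg = ν) {s : ℝ} (hs : s ∈ Ioo (1 / 2 : ℝ) 1) :
    0 ≤ quantile ν s := by
  by_contra! hneg
  have hle := (quantile_le_iff ⟨by linarith [hs.1], hs.2⟩ _).1 (le_refl (quantile ν s))
  have hdisj : Disjoint (Iic (quantile ν s)) (Ici (-quantile ν s)) :=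
    Set.disjoint_left.2 fun y hy hy' => by
      rw [mem_Iic] at hy
      rw [mem_Ici] at hy'
      linarith
  have h := measureReal_union hdisj (μ := ν) measurableSet_Ici
  rw [measureReal_Ici_neg hsymm, ← cdf_eq_real] at h
  have hone : ν.real (Iic (quantile ν s) ∪ Ici (-quantile ν s)) ≤ 1 := measureReal_le_one
  linarith [hs.1]

lemma setIntegral_quantile_half (hsymm : ν.map Neg.neg = ν) :
    ∫ s in Ioc (1 - 1 / 2 : ℝ) 1, quantile ν s = ∫ x, max x 0 ∂ν := by
  have hhalf : (1 - 1 / 2 : ℝ) = 1 / 2 := by norm_num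
  rw [← setIntegral_max_quantile_zero, hhalf]
  calc ∫ s in Ioc (1 / 2 : ℝ) 1, quantile ν s
      = ∫ s in Ioc (1 / 2 : ℝ) 1, max (quantile ν s) 0 := by
        rw [integral_Ioc_eq_integral_Ioo, integral_Ioc_eq_integral_Ioo]
        exact setIntegral_congr_fun measurableSet_Ioo fun s hs =>
          (max_eq_left (quantile_nonneg hsymm hs)).symm
    _ = ∫ s in Ioc (0 : ℝ) 1, max (quantile ν s) 0 := by
        refine (setIntegral_eq_of_subset_of_forall_sdiff_eq_zero measurableSet_Ioc
          (Ioc_subset_Ioc_left (by norm_num)) fun s hs => max_eq_right ?_).symm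
        refine quantile_nonpos hsymm ⟨hs.1.1, ?_⟩
        by_contra! h
        exact hs.2 ⟨h, hs.1.2⟩

/-- Among all `t ∈ (0, 1]`, the product `t e_t` of a symmetric law is largest at `t = 1 / 2`. -/
lemma two_mul_mul_avgQuantile_le (hInt : Integrable (fun x : ℝ => x) ν)
    (hsymm : ν.map Neg.neg = ν) {t : ℝ} (ht : t ∈ Ioc (0 : ℝ) 1) :
    2 * (t * avgQuantile ν t) ≤ ∫ x, |x| ∂ν := by
  rw [mul_avgQuantile ht.1, integral_abs_of_symmetric hInt hsymm]
  linarith [setIntegral_quantile_le hInt ht]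

lemma avgQuantile_half (hInt : Integrable (fun x : ℝ => x) ν) (hsymm : ν.map Neg.neg = ν) :
    avgQuantile ν (1 / 2) = ∫ x, |x| ∂ν := by
  rw [avgQuantile, setIntegral_quantile_half hsymm, integral_abs_of_symmetric hInt hsymm]
  norm_num

lemma two_mul_iSup_mul_avgQuantile (hInt : Integrable (fun x : ℝ => x) ν)
    (hsymm : ν.map Neg.neg = ν) :
    2 * ⨆ t : Ioc (0 : ℝ) 1, (t : ℝ) * avgQuantile ν t = ∫ x, |x| ∂ν := by
  have hle : ∀ t : Ioc (0 : ℝ) 1, (t : ℝ) * avgQuantile ν t ≤ (∫ x, |x| ∂ν) / 2 := fun t => by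
    linarith [two_mul_mul_avgQuantile_le hInt hsymm t.2]
  have hhalf : (1 / 2 : ℝ) ∈ Ioc (0 : ℝ) 1 := by norm_num
  have : Nonempty (Ioc (0 : ℝ) 1) := ⟨⟨_, hhalf⟩⟩
  have hge := le_ciSup (f := fun t : Ioc (0 : ℝ) 1 => (t : ℝ) * avgQuantile ν t)
    ⟨_, forall_mem_range.2 hle⟩ ⟨1 / 2, hhalf⟩
  simp only [avgQuantile_half hInt hsymm] at hge
  linarith [ciSup_le hle]

end Quantile

section UniformLaw

variable {d : ℕ} {K : Set (EuclideanSpace ℝ (Fin d))}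

lemma integral_unifOn (f : EuclideanSpace ℝ (Fin d) → ℝ) :
    ∫ y, f y ∂unifOn K = (volume K).toReal⁻¹ * ∫ y in K, f y := by
  rw [unifOn, integral_smul_measure, ENNReal.toReal_inv, smul_eq_mul]

lemma map_neg_unifOn (hKsymm : K = -K) : (unifOn K).map Neg.neg = unifOn K := by
  have hpre : Neg.neg ⁻¹' K = K := hKsymm.symm
  have h := ((Measure.measurePreserving_neg (volume : Measure (EuclideanSpace ℝ (Fin d)))
    ).restrict_preimage_emb (Homeomorph.neg _).measurableEmbedding K).map_eq
  rw [hpre] at h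
  rw [unifOn, Measure.map_smul, h]

lemma integrable_unifOn (hK : IsCompact K) (hK0 : volume K ≠ 0)
    {f : EuclideanSpace ℝ (Fin d) → ℝ} (hf : Continuous f) : Integrable f (unifOn K) :=
  (hf.continuousOn.integrableOn_compact hK).smul_measure (ENNReal.inv_ne_top.2 hK0)

lemma map_neg_map_inner_unifOn (hKsymm : K = -K) (u : EuclideanSpace ℝ (Fin d)) :
    ((unifOn K).map fun y => ⟪y, u⟫).map Neg.neg = (unifOn K).map fun y => ⟪y, u⟫ := by
  have hm : Measurable fun y : EuclideanSpace ℝ (Fin d) => (⟪y, u⟫ : ℝ) :=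
    (by fun_prop : Continuous fun y : EuclideanSpace ℝ (Fin d) => (⟪y, u⟫ : ℝ)).measurable
  conv_rhs => rw [← map_neg_unifOn hKsymm]
  rw [Measure.map_map measurable_neg hm, Measure.map_map hm measurable_neg]
  congr 1
  ext y
  simp

end UniformLaw

lemma isClosed_setOf_forall_inner_le {E : Type*} [NormedAddCommGroup E] [InnerProductSpace ℝ E]
    (h : E → ℝ) : IsClosed {x : E | ∀ u, ⟪x, u⟫ ≤ h u} := by
  rw [Set.ofPred_forall]
  exact isClosed_iInter fun u => isClosed_le (by fun_prop) continuous_const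

lemma convex_setOf_forall_inner_le {E : Type*} [NormedAddCommGroup E] [InnerProductSpace ℝ E]
    (h : E → ℝ) : Convex ℝ {x : E | ∀ u, ⟪x, u⟫ ≤ h u} := by
  intro x hx y hy a b ha hb hab u
  rw [inner_add_left, real_inner_smul_left, real_inner_smul_left]
  calc a * ⟪x, u⟫ + b * ⟪y, u⟫ ≤ a * h u + b * h u :=
        add_le_add (mul_le_mul_of_nonneg_left (hx u) ha) (mul_le_mul_of_nonneg_left (hy u) hb)
    _ = h u := by rw [← add_mul, hab, one_mul]

/-- for an origin symmetric convex body `K ⊆ ℝ^d`, the centroid body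
satisfies `Γ K = 2 conv(∪_{t ∈ (0,1]} t E_t(K))`; equivalently, for every `u ∈ ℝ^d`,
`(1/V_d(K)) ∫_K |⟨x,u⟩| dx = 2 sup_{t ∈ (0,1]} t e_t(⟨ξ,u⟩)`, with `ξ` uniformly
distributed on `K`. -/
theorem statement19
    {Ω : Type*} [MeasureSpace Ω] [IsProbabilityMeasure (volume : Measure Ω)]
    {d : ℕ}
    (K : Set (EuclideanSpace ℝ (Fin d)))
    (hKcpt : IsCompact K) (hKconv : Convex ℝ K) (hKint : (interior K).Nonempty)
    (hKsymm : K = -K)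
    (ξ : Ω → EuclideanSpace ℝ (Fin d)) (hξmeas : Measurable ξ)
    (hξlaw : Measure.map ξ volume = unifOn K) :
    centroidBody K =
      (2 : ℝ) • closure (convexHull ℝ
        (⋃ t ∈ Set.Ioc (0:ℝ) 1, t • avgQuantileSet ξ t)) ∧
    (∀ u : EuclideanSpace ℝ (Fin d),
      (volume K).toReal⁻¹ * ∫ y in K, |⟪y, u⟫| =
        2 * ⨆ t : Set.Ioc (0:ℝ) 1,
          (t : ℝ) * avgQuantile (Measure.map (fun ω => ⟪ξ ω, u⟫) volume) t) := by
  have hprob : IsProbabilityMeasure (unifOn K) :=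
    hξlaw ▸ Measure.isProbabilityMeasure_map hξmeas.aemeasurable
  have hK0 : volume K ≠ 0 :=
    ((isOpen_interior.measure_pos volume hKint).trans_le (measure_mono interior_subset)).ne'
  have hcont : ∀ u : EuclideanSpace ℝ (Fin d),
      Continuous fun y : EuclideanSpace ℝ (Fin d) => (⟪y, u⟫ : ℝ) := fun u => by fun_prop
  have hmap : ∀ u : EuclideanSpace ℝ (Fin d), Measure.map (fun ω => (⟪ξ ω, u⟫ : ℝ)) volume =
      (unifOn K).map fun y => ⟪y, u⟫ := fun u => by
    rw [← hξlaw, Measure.map_map (hcont u).measurable hξmeas]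
    rfl
  have hlaw : ∀ u : EuclideanSpace ℝ (Fin d),
      IsProbabilityMeasure ((unifOn K).map fun y => (⟪y, u⟫ : ℝ)) := fun u =>
    Measure.isProbabilityMeasure_map (hcont u).measurable.aemeasurable
  have hInt : ∀ u : EuclideanSpace ℝ (Fin d),
      Integrable (fun x : ℝ => x) ((unifOn K).map fun y => ⟪y, u⟫) := fun u =>
    (integrable_map_measure (by fun_prop) (hcont u).measurable.aemeasurable).2
      (integrable_unifOn hKcpt hK0 (hcont u))
  have hsymm := map_neg_map_inner_unifOn hKsymm
  have habs : ∀ u : EuclideanSpace ℝ (Fin d),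
      ∫ x, |x| ∂((unifOn K).map fun y => (⟪y, u⟫ : ℝ)) =
        (volume K).toReal⁻¹ * ∫ y in K, |⟪y, u⟫| := fun u => by
    rw [integral_map (hcont u).measurable.aemeasurable (by fun_prop), integral_unifOn]
  refine ⟨?_, fun u => ?_⟩
  · have hhalf : avgQuantileSet ξ (1 / 2) = centroidBody K := by
      simp only [avgQuantileSet, centroidBody, hmap, avgQuantile_half (hInt _) (hsymm _), habs]
    apply Set.Subset.antisymm
    · intro x hx
      refine ⟨(1 / 2 : ℝ) • x, subset_closure (subset_convexHull ℝ _ ?_), ?_⟩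
      · rw [← hhalf] at hx
        exact Set.mem_iUnion₂.2 ⟨1 / 2, by norm_num, Set.smul_mem_smul_set hx⟩
      · simp [smul_smul]
    · rw [← closure_smul₀, ← convexHull_smul]
      refine closure_minimal (convexHull_min ?_ (convex_setOf_forall_inner_le _))
        (isClosed_setOf_forall_inner_le _)
      rintro _ ⟨y, hy, rfl⟩ u
      obtain ⟨t, ht, x, hx, rfl⟩ := Set.mem_iUnion₂.1 hy
      have hxu := hx u
      have hle := two_mul_mul_avgQuantile_le (hInt u) (hsymm u) ht
      rw [hmap u] at hxu
      simp only [real_inner_smul_left]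
      rw [← habs u]
      exact (by gcongr; exact ht.1.le : _ ≤ 2 * (t * avgQuantile _ t)).trans hle
  · rw [hmap u, two_mul_iSup_mul_avgQuantile (hInt u) (hsymm u), habs u]
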